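/- arXiv:2103.00263 — 7 statements merged into one kernel-verified Lean document; each statement's English description precedes it below -/
import Mathlib

section
/- Let d ≥ 1 and let G : 𝕊 × 𝕊 → 𝕊 be a function whose induced graph is monotone, i.e. for any pairs (a₁,b₁), (a₂,b₂) ∈ 𝕊 × 𝕊 with G(a₁,b₁) = 0 and G(a₂,b₂) = 0 one has (a₁ − a₂) : (b₁ − b₂) ≥ 0. Fix ε > 0 and define the regularised function G_ε(σ,τ) := G(σ − ετ, τ − εσ). Then for any (σ₁,τ₁), (σ₂,τ₂) ∈ 𝕊 × 𝕊 with G_ε(σ₁,τ₁) = 0 and G_ε(σ₂,τ₂) = 0, one has (σ₁ − σ₂) : (τ₁ − τ₂) ≥ (ε/(1+ε²)) (|σ₁ − σ₂|² + |τ₁ − τ₂|²). -/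
open scoped RealInnerProductSpace
open Asymptotics Filter

/-- The space `𝕊` of symmetric `d × d` real matrices (a matrix being identified with the
family of its entries, indexed by `Fin d × Fin d`), realised as a submodule of the
Euclidean space `EuclideanSpace ℝ (Fin d × Fin d)`.  It thereby carries exactly the
Frobenius inner product `⟪σ, τ⟫ = tr (σ τᵀ) = ∑ i j, σ i j * τ i j` and the induced
Frobenius norm. -/
def SymMat (d : ℕ) : Submodule ℝ (EuclideanSpace ℝ (Fin d × Fin d)) where
  carrier := {A | ∀ i j : Fin d, A (i, j) = A (j, i)}
  add_mem' := fun {a b} ha hb i j => by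
    simp only [PiLp.add_apply, ha i j, hb i j]
  zero_mem' := fun i j => rfl
  smul_mem' := fun c a ha i j => by
    simp only [PiLp.smul_apply, ha i j]

theorem reg_aux {E : Type*} [NormedAddCommGroup E] [InnerProductSpace ℝ E] (ε : ℝ)
    (s t : E) (h : 0 ≤ ⟪s - ε • t, t - ε • s⟫) :
    ε / (1 + ε ^ 2) * (‖s‖ ^ 2 + ‖t‖ ^ 2) ≤ ⟪s, t⟫ := by
  simp only [inner_sub_left, inner_sub_right, real_inner_smul_left, real_inner_smul_right,
    real_inner_self_eq_norm_sq] at h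
  have hc : ⟪t, s⟫ = ⟪s, t⟫ := real_inner_comm s t
  rw [hc] at h
  rw [div_mul_eq_mul_div, div_le_iff₀ (by positivity)]
  linarith

/-- If the graph induced by `G` is monotone, then the graph induced by the
regularised function `G_ε(σ,τ) = G(σ - ετ, τ - εσ)` is uniformly monotone with constant
`ε / (1 + ε²)`. -/
theorem regularised_graph_uniformly_monotone {d : ℕ} (hd : 1 ≤ d)
    (G : SymMat d → SymMat d → SymMat d)
    (hmono : ∀ a₁ b₁ a₂ b₂ : SymMat d, G a₁ b₁ = 0 → G a₂ b₂ = 0 →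
      0 ≤ ⟪a₁ - a₂, b₁ - b₂⟫)
    (ε : ℝ) (hε : 0 < ε)
    (Gε : SymMat d → SymMat d → SymMat d)
    (hGε : ∀ σ τ : SymMat d, Gε σ τ = G (σ - ε • τ) (τ - ε • σ))
    (σ₁ τ₁ σ₂ τ₂ : SymMat d)
    (h₁ : Gε σ₁ τ₁ = 0) (h₂ : Gε σ₂ τ₂ = 0) :
    ε / (1 + ε ^ 2) * (‖σ₁ - σ₂‖ ^ 2 + ‖τ₁ - τ₂‖ ^ 2) ≤ ⟪σ₁ - σ₂, τ₁ - τ₂⟫ := by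
  have h := hmono _ _ _ _ ((hGε σ₁ τ₁).symm.trans h₁) ((hGε σ₂ τ₂).symm.trans h₂)
  have e1 : σ₁ - ε • τ₁ - (σ₂ - ε • τ₂) = (σ₁ - σ₂) - ε • (τ₁ - τ₂) := by
    rw [smul_sub]; abel
  have e2 : τ₁ - ε • σ₁ - (τ₂ - ε • σ₂) = (τ₁ - τ₂) - ε • (σ₁ - σ₂) := by
    rw [smul_sub]; abel
  rw [e1, e2] at h
  generalize σ₁ - σ₂ = s at *
  generalize τ₁ - τ₂ = t at *
  exact reg_aux ε s t h
end

section
/- Let d ≥ 1, r > 1 with Hölder conjugate r' = r/(r−1), and let G : 𝕊 × 𝕊 → 𝕊 satisfy the r-coercivity condition: there exist constants c₁, c₂ > 0 such that for every (a,b) ∈ 𝕊 × 𝕊 with G(a,b) = 0 one has a : b ≥ c₁(|a|^{r'} + |b|^{r}) − c₂. Fix ε > 0 and define the regularised function G_ε(σ,τ) := G(σ − ετ, τ − εσ). Then there exist constants c, c̃ > 0 (for instance c = ε/(1+ε²) and c̃ = c₂/(1+ε²)) such that for every (σ,τ) ∈ 𝕊 × 𝕊 with G_ε(σ,τ) = 0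 one has σ : τ ≥ c(|σ|² + |τ|²) − c̃. -/
open scoped RealInnerProductSpace
open Asymptotics Filter

theorem aux_inner {E : Type*} [NormedAddCommGroup E] [InnerProductSpace ℝ E] (σ τ : E) (ε : ℝ) :
    ⟪σ - ε • τ, τ - ε • σ⟫ = (1 + ε ^ 2) * ⟪σ, τ⟫ - ε * (‖σ‖ ^ 2 + ‖τ‖ ^ 2) := by
  simp only [inner_sub_left, inner_sub_right, real_inner_smul_left, real_inner_smul_right,
    real_inner_self_eq_norm_sq, real_inner_comm σ τ]
  ring

/-- If the graph induced by `G` is `r`-coercive, then the graph induced by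
the regularised function `G_ε(σ,τ) = G(σ - ετ, τ - εσ)` is `2`-coercive: there are
constants `c, c̃ > 0` such that `⟪σ, τ⟫ ≥ c (‖σ‖² + ‖τ‖²) - c̃` whenever `G_ε(σ,τ) = 0`. -/
theorem regularised_graph_two_coercive {d : ℕ} (hd : 1 ≤ d)
    (r : ℝ) (hr : 1 < r)
    (G : SymMat d → SymMat d → SymMat d)
    (c₁ c₂ : ℝ) (hc₁ : 0 < c₁) (hc₂ : 0 < c₂)
    (hcoer : ∀ a b : SymMat d, G a b = 0 →
      c₁ * (‖a‖ ^ (r / (r - 1)) + ‖b‖ ^ r) - c₂ ≤ ⟪a, b⟫)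
    (ε : ℝ) (hε : 0 < ε)
    (Gε : SymMat d → SymMat d → SymMat d)
    (hGε : ∀ σ τ : SymMat d, Gε σ τ = G (σ - ε • τ) (τ - ε • σ)) :
    ∃ c ct : ℝ, 0 < c ∧ 0 < ct ∧
      ∀ σ τ : SymMat d, Gε σ τ = 0 →
        c * (‖σ‖ ^ 2 + ‖τ‖ ^ 2) - ct ≤ ⟪σ, τ⟫ := by
  have hp : 0 < 1 + ε ^ 2 := by positivity
  refine ⟨ε / (1 + ε ^ 2), c₂ / (1 + ε ^ 2), by positivity, by positivity, ?_⟩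
  intro σ τ h
  rw [hGε] at h
  have h1 := hcoer _ _ h
  have h2 : 0 ≤ c₁ * (‖σ - ε • τ‖ ^ (r / (r - 1)) + ‖τ - ε • σ‖ ^ r) := by positivity
  have h3 : ⟪σ - ε • τ, τ - ε • σ⟫ =
      (1 + ε ^ 2) * ⟪σ, τ⟫ - ε * (‖σ‖ ^ 2 + ‖τ‖ ^ 2) := aux_inner σ τ ε
  have h4 : ε / (1 + ε ^ 2) * (‖σ‖ ^ 2 + ‖τ‖ ^ 2) - c₂ / (1 + ε ^ 2) =
      (ε * (‖σ‖ ^ 2 + ‖τ‖ ^ 2) - c₂) / (1 + ε ^ 2) := by ring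
  rw [h4, div_le_iff₀ hp]
  linarith
end

section
/- Let X and Z be real Banach spaces, let U be an open neighborhood of a point z* ∈ Z, and let F : Z → X satisfy F(z*) = 0. Let ∂F be a set-valued map assigning to each z ∈ U a nonempty set ∂F(z) of continuous linear operators from Z to X. Assume: (i) F is ∂F-semismooth at z*, i.e. sup_{M ∈ ∂F(z*+h)} ‖F(z*+h) − F(z*) − M h‖_X = o(‖h‖_Z) as h → 0; (ii) there exists c > 0 such that for every z ∈ U and every M ∈ ∂F(z), M is invertible (a bijection with continuous inverse) and ‖M⁻¹‖_{L(X;Z)} ≤ c. Then there exists δ > 0 such that for every z⁰ with ‖z⁰ − z*‖_Z < δ and every sequence (z^j) generated by the generalised Newton iteration z^{j+1} = z^j − M_j⁻¹ F(z^j) with arbitrary choices M_j ∈ ∂F(z^j), all iterates z^j remain in U, z^j → z*, and the convergence is superlinear: for every η > 0 there exists J such that ‖z^{j+1} − z*‖_Z ≤ η ‖z^j − z*‖_Z for all j ≥ J. -/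
open Filter

/-- Superlinear local convergence of the semismooth Newton method in Banach
spaces: if `F` is `∂F`-semismooth at a root `z*` and the generalised Jacobians are uniformly
invertible on a neighbourhood `U` of `z*`, then every generalised Newton sequence started
sufficiently close to `z*` stays in `U` and converges superlinearly to `z*`. -/
theorem semismooth_newton_superlinear_convergence {X Z : Type*}
    [NormedAddCommGroup X] [NormedSpace ℝ X] [CompleteSpace X]
    [NormedAddCommGroup Z] [NormedSpace ℝ Z] [CompleteSpace Z]
    (U : Set Z) (hU : IsOpen U) (zstar : Z) (hzU : zstar ∈ U)
    (F : Z → X) (hFz : F zstar = 0)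
    (DF : Z → Set (Z →L[ℝ] X))
    (hne : ∀ z ∈ U, (DF z).Nonempty)
    -- (i) `F` is `∂F`-semismooth at `z*`:
    -- `sup_{M ∈ ∂F(z*+h)} ‖F(z*+h) - F(z*) - M h‖ = o(‖h‖)` as `h → 0`.
    (hsemi : ∀ ε : ℝ, 0 < ε → ∃ δ : ℝ, 0 < δ ∧ ∀ h : Z, ‖h‖ < δ →
      ∀ M ∈ DF (zstar + h), ‖F (zstar + h) - F zstar - M h‖ ≤ ε * ‖h‖)
    -- (ii) uniform invertibility of the generalised Jacobians on `U`.
    (c : ℝ) (hc : 0 < c)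
    (hinv : ∀ z ∈ U, ∀ M ∈ DF z, ∃ N : X →L[ℝ] Z,
      (∀ x : X, M (N x) = x) ∧ (∀ w : Z, N (M w) = w) ∧ ‖N‖ ≤ c) :
    ∃ δ : ℝ, 0 < δ ∧ ∀ z0 : Z, ‖z0 - zstar‖ < δ →
      ∀ zseq : ℕ → Z, ∀ Mseq : ℕ → (Z →L[ℝ] X),
        zseq 0 = z0 →
        (∀ j : ℕ, Mseq j ∈ DF (zseq j)) →
        -- the Newton iteration `z^{j+1} = z^j - M_j⁻¹ F(z^j)`, i.e.
        -- `M_j (z^j - z^{j+1}) = F(z^j)`.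
        (∀ j : ℕ, Mseq j (zseq j - zseq (j + 1)) = F (zseq j)) →
        (∀ j : ℕ, zseq j ∈ U) ∧
        Tendsto zseq atTop (nhds zstar) ∧
        ∀ η : ℝ, 0 < η → ∃ J : ℕ, ∀ j : ℕ, J ≤ j →
          ‖zseq (j + 1) - zstar‖ ≤ η * ‖zseq j - zstar‖ := by
  have key : ∀ η : ℝ, 0 < η → ∃ δ : ℝ, 0 < δ ∧ ∀ z ∈ U, ‖z - zstar‖ < δ → ∀ M ∈ DF z,
      ∀ w : Z, M (z - w) = F z → ‖w - zstar‖ ≤ η * ‖z - zstar‖ := by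
    intro η hη
    obtain ⟨δ, hδ, H⟩ := hsemi (η / c) (div_pos hη hc)
    refine ⟨δ, hδ, fun z hz hzd M hM w hw => ?_⟩
    obtain ⟨N, -, hN2, hN3⟩ := hinv z hz M hM
    have h1 := H (z - zstar) hzd M (by simpa using hM)
    rw [add_sub_cancel, hFz, sub_zero] at h1
    have h2 : w - zstar = - N (F z - M (z - zstar)) := by
      rw [← hw, ← map_sub, hN2]
      abel
    calc ‖w - zstar‖ = ‖N (F z - M (z - zstar))‖ := by rw [h2, norm_neg]
      _ ≤ c * ‖F z - M (z - zstar)‖ := N.le_of_opNorm_le hN3 _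
      _ ≤ c * (η / c * ‖z - zstar‖) := by gcongr
      _ = η * ‖z - zstar‖ := by field_simp
  obtain ⟨δ₁, hδ₁, H₁⟩ := key (1 / 2) (by norm_num)
  obtain ⟨r, hr, hball⟩ := Metric.isOpen_iff.1 hU zstar hzU
  refine ⟨min δ₁ r, lt_min hδ₁ hr, ?_⟩
  intro z0 hz0 zseq Mseq h0 hM hstep
  have hinU : ∀ z, ‖z - zstar‖ < min δ₁ r → z ∈ U := fun z hz =>
    hball (by rw [mem_ball_iff_norm]; exact hz.trans_le (min_le_right _ _))
  have hcontr : ∀ j, ‖zseq j - zstar‖ < min δ₁ r →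
      ‖zseq (j + 1) - zstar‖ ≤ 1 / 2 * ‖zseq j - zstar‖ := fun j hj =>
    H₁ _ (hinU _ hj) (hj.trans_le (min_le_left _ _)) _ (hM j) _ (hstep j)
  have hnear : ∀ j, ‖zseq j - zstar‖ < min δ₁ r := by
    intro j
    induction j with
    | zero => rw [h0]; exact hz0
    | succ j ih =>
      have := hcontr j ih
      have := norm_nonneg (zseq j - zstar)
      linarith
  have hgeo : ∀ j, ‖zseq j - zstar‖ ≤ (1 / 2 : ℝ) ^ j * ‖zseq 0 - zstar‖ := by
    intro j
    induction j with
    | zero => simp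
    | succ j ih =>
      have := hcontr j (hnear j)
      rw [pow_succ]
      linarith
  have hlim0 : Tendsto (fun j => ‖zseq j - zstar‖) atTop (nhds 0) := by
    refine squeeze_zero (fun _ => norm_nonneg _) hgeo ?_
    have := (tendsto_pow_atTop_nhds_zero_of_lt_one (r := (1 / 2 : ℝ)) (by norm_num)
      (by norm_num)).mul_const ‖zseq 0 - zstar‖
    simpa using this
  refine ⟨fun j => hinU _ (hnear j), tendsto_iff_norm_sub_tendsto_zero.2 hlim0, ?_⟩
  intro η hη
  obtain ⟨δ, hδ, H⟩ := key η hη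
  obtain ⟨J, hJ⟩ := eventually_atTop.1 (hlim0.eventually (gt_mem_nhds hδ))
  exact ⟨J, fun j hj => H _ (hinU _ (hnear j)) (hJ j hj) _ (hM j) _ (hstep j)⟩
end

section
/- Let d ≥ 1, τ* ≥ 0 and ν > 0, and define G : 𝕊 × 𝕊 → 𝕊 by G(σ,τ) := |τ| σ − (τ* + 2ν|τ|) τ. Define the generalised Jacobian ∂G(σ,τ) as follows: if τ ≠ 0, ∂G(σ,τ) is the singleton containing the linear map (s,t) ↦ |τ| s + ((τ : t)/|τ|) σ − τ* t − 2ν(|τ| t + ((τ : t)/|τ|) τ); if τ = 0, ∂G(σ,0) := { (s,t) ↦ (t : φ) σ − τ* t : φ ∈ 𝕊, |φ| ≤ 1 }. Then G is ∂G-semismooth at every point of the form (σ₀, 0): for every σ₀ ∈ 𝕊 and every increment (σ̃,τ̃), sup_{M ∈ ∂G(σ₀+σ̃, τ̃)} ‖G(σ₀+σ̃, τ̃) − G(σ₀, 0) − M(σ̃,τ̃)‖ ≤ |τ̃| |σ̃| + 2ν |τ̃|² ≤ (1 + 2ν)(|σ̃|² + |τ̃|²), which is o(‖(σ̃,τ̃)‖)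 as (σ̃,τ̃) → (0,0). -/
open scoped RealInnerProductSpace
open Asymptotics Filter

/-- The Bingham function `G(σ,τ) = ‖τ‖ σ - (τ* + 2ν‖τ‖) τ` is
`∂G`-semismooth at every point of the form `(σ₀, 0)`: for every increment `(σ̃, τ̃)` and
every `M` in the generalised Jacobian `∂G(σ₀+σ̃, τ̃)`, the Newton remainder is bounded by
`‖τ̃‖‖σ̃‖ + 2ν‖τ̃‖² ≤ (1 + 2ν)(‖σ̃‖² + ‖τ̃‖²)`, which is `o(‖(σ̃,τ̃)‖)` as `(σ̃,τ̃) → 0`. -/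
theorem bingham_semismooth_at_zero_strain {d : ℕ} (hd : 1 ≤ d)
    (τs ν : ℝ) (hτs : 0 ≤ τs) (hν : 0 < ν)
    (G : SymMat d → SymMat d → SymMat d)
    (hG : ∀ σ τ : SymMat d, G σ τ = ‖τ‖ • σ - (τs + 2 * ν * ‖τ‖) • τ)
    (Jac : SymMat d → SymMat d → Set (SymMat d × SymMat d → SymMat d))
    (hJac : ∀ (σ τ : SymMat d) (M : SymMat d × SymMat d → SymMat d), M ∈ Jac σ τ ↔
      (τ ≠ 0 ∧ ∀ s t : SymMat d,
        M (s, t) = ‖τ‖ • s + (⟪τ, t⟫ / ‖τ‖) • σ - τs • t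
          - (2 * ν) • (‖τ‖ • t + (⟪τ, t⟫ / ‖τ‖) • τ)) ∨
      (τ = 0 ∧ ∃ φ : SymMat d, ‖φ‖ ≤ 1 ∧
        ∀ s t : SymMat d, M (s, t) = ⟪t, φ⟫ • σ - τs • t)) :
    (∀ σ₀ σt τt : SymMat d, ∀ M ∈ Jac (σ₀ + σt) τt,
      ‖G (σ₀ + σt) τt - G σ₀ 0 - M (σt, τt)‖ ≤ ‖τt‖ * ‖σt‖ + 2 * ν * ‖τt‖ ^ 2 ∧
      ‖τt‖ * ‖σt‖ + 2 * ν * ‖τt‖ ^ 2 ≤ (1 + 2 * ν) * (‖σt‖ ^ 2 + ‖τt‖ ^ 2)) ∧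
    ((fun p : SymMat d × SymMat d => ‖p.2‖ * ‖p.1‖ + 2 * ν * ‖p.2‖ ^ 2)
      =o[nhds (0 : SymMat d × SymMat d)] fun p : SymMat d × SymMat d => ‖p‖) := by
  refine ⟨fun σ₀ σt τt M hM => ⟨?_, ?_⟩, ?_⟩
  · rcases (hJac _ _ _).1 hM with ⟨h0, h⟩ | ⟨h0, φ, _, h⟩
    · have hn : ‖τt‖ ≠ 0 := norm_ne_zero_iff.2 h0
      have hq : (⟪τt, τt⟫ : ℝ) / ‖τt‖ = ‖τt‖ := by
        rw [real_inner_self_eq_norm_sq]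
        field_simp
      have key : G (σ₀ + σt) τt - G σ₀ 0 - M (σt, τt)
          = (2 * ν * ‖τt‖) • τt - ‖τt‖ • σt := by
        rw [h, hq, hG, hG, norm_zero]
        module
      rw [key]
      refine (norm_sub_le _ _).trans (le_of_eq ?_)
      rw [norm_smul, norm_smul, norm_norm, Real.norm_of_nonneg (by positivity)]
      ring
    · subst h0
      rw [h, hG, hG]
      simp
  · nlinarith [sq_nonneg (‖τt‖ - ‖σt‖), sq_nonneg ‖τt‖, sq_nonneg ‖σt‖,
      mul_nonneg hν.le (sq_nonneg ‖σt‖)]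
  · have hO : (fun p : SymMat d × SymMat d => ‖p.2‖ * ‖p.1‖ + 2 * ν * ‖p.2‖ ^ 2)
        =O[nhds (0 : SymMat d × SymMat d)] fun p : SymMat d × SymMat d => ‖p‖ ^ 2 := by
      refine IsBigO.of_bound (1 + 2 * ν) (Eventually.of_forall fun p => ?_)
      rw [Real.norm_of_nonneg (by positivity), Real.norm_of_nonneg (by positivity)]
      have h1 := norm_fst_le p
      have h2 := norm_snd_le p
      have h3 : ‖p.2‖ * ‖p.1‖ ≤ ‖p‖ * ‖p‖ := by gcongr
      have h4 : 2 * ν * ‖p.2‖ ^ 2 ≤ 2 * ν * ‖p‖ ^ 2 := by gcongr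
      nlinarith
    refine hO.trans_isLittleO ?_
    have h5 : (fun p : SymMat d × SymMat d => ‖p‖)
        =o[nhds (0 : SymMat d × SymMat d)] fun _ => (1 : ℝ) := by
      rw [isLittleO_one_iff]
      exact tendsto_norm_zero
    have h6 := h5.mul_isBigO
      (isBigO_refl (fun p : SymMat d × SymMat d => ‖p‖) (nhds (0 : SymMat d × SymMat d)))
    simpa [sq] using h6
end

section
/- Let d ≥ 1, τ* > 0 and ν > 0, and define G : 𝕊 × 𝕊 → 𝕊 by G(σ,τ) := (|σ| − τ*)⁺ σ − 2ν(τ* + (|σ| − τ*)⁺) τ, where x⁺ := max{x,0}. Define the generalised Jacobian ∂G(σ,τ) as follows: if |σ| ≠ τ*, ∂G(σ,τ) is the singleton containing the linear map (s,t) ↦ (|σ| − τ*)⁺ s + 1_{|σ|>τ*} ((σ : s)/|σ|)(σ − 2ντ) − 2ν(τ* + (|σ| − τ*)⁺) t; if |σ| = τ*, ∂G(σ,τ) := { (s,t) ↦ (s : φ)(σ − 2ντ) − 2ν τ* t : φ ∈ 𝕊, |φ| ≤ 1 }. Then for every (σ,τ) with |σ| = τ* and every α ∈ (0,1), sup_{M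 ∈ ∂G(σ + σ̃, τ + τ̃)} ‖G(σ + σ̃, τ + τ̃) − G(σ,τ) − M(σ̃,τ̃)‖ = o(‖(σ̃,τ̃)‖^α) as (σ̃,τ̃) → (0,0). -/
open scoped RealInnerProductSpace
open Asymptotics Filter

/-- For the Bingham function
`G(σ,τ) = (‖σ‖ - τ*)⁺ σ - 2ν(τ* + (‖σ‖ - τ*)⁺) τ` and its generalised Jacobian `∂G`,
at every point `(σ,τ)` with `‖σ‖ = τ*` and for every `α ∈ (0,1)`, the semismoothness-type
remainder is `o(‖(σ̃,τ̃)‖^α)` as `(σ̃,τ̃) → 0`. -/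
theorem bingham_max_form_alpha_order_semismooth {d : ℕ} (hd : 1 ≤ d)
    (τs ν : ℝ) (hτs : 0 < τs) (hν : 0 < ν)
    (G : SymMat d → SymMat d → SymMat d)
    (hG : ∀ σ τ : SymMat d,
      G σ τ = max (‖σ‖ - τs) 0 • σ - (2 * ν * (τs + max (‖σ‖ - τs) 0)) • τ)
    (Jac : SymMat d → SymMat d → Set (SymMat d × SymMat d → SymMat d))
    (hJac : ∀ (σ τ : SymMat d) (M : SymMat d × SymMat d → SymMat d), M ∈ Jac σ τ ↔
      (‖σ‖ ≠ τs ∧ ∀ s t : SymMat d,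
        M (s, t) = max (‖σ‖ - τs) 0 • s
          + (if τs < ‖σ‖ then ⟪σ, s⟫ / ‖σ‖ else 0) • (σ - (2 * ν) • τ)
          - (2 * ν * (τs + max (‖σ‖ - τs) 0)) • t) ∨
      (‖σ‖ = τs ∧ ∃ φ : SymMat d, ‖φ‖ ≤ 1 ∧ ∀ s t : SymMat d,
        M (s, t) = ⟪s, φ⟫ • (σ - (2 * ν) • τ) - (2 * ν * τs) • t))
    (σ τ : SymMat d) (hσ : ‖σ‖ = τs)
    (α : ℝ) (hα0 : 0 < α) (hα1 : α < 1) :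
    ∀ ε : ℝ, 0 < ε → ∃ δ : ℝ, 0 < δ ∧ ∀ σt τt : SymMat d,
      0 < ‖(σt, τt)‖ → ‖(σt, τt)‖ < δ →
      ∀ M ∈ Jac (σ + σt) (τ + τt),
        ‖G (σ + σt) (τ + τt) - G σ τ - M (σt, τt)‖ ≤ ε * ‖(σt, τt)‖ ^ α := by
  intro ε hε
  set A : ℝ := ‖σ - (2 * ν) • τ‖ with hA
  have hA0 : 0 ≤ A := norm_nonneg _
  set C : ℝ := 2 * A + 1 + 2 * ν with hC
  have hC0 : 0 < C := by positivity
  have h1α : 0 < 1 - α := by linarith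
  refine ⟨min 1 ((ε / C) ^ (1 / (1 - α))), by positivity, ?_⟩
  intro σt τt h0 hlt M hM
  set h : ℝ := ‖(σt, τt)‖ with hh
  have hh1 : h < 1 := lt_of_lt_of_le hlt (min_le_left _ _)
  have hh2 : h < (ε / C) ^ (1 / (1 - α)) := lt_of_lt_of_le hlt (min_le_right _ _)
  have hσt : ‖σt‖ ≤ h := norm_fst_le (σt, τt)
  have hτt : ‖τt‖ ≤ h := norm_snd_le (σt, τt)
  have hpow : C * h ≤ ε * h ^ α := by
    have e1 : h ^ (1 - α) ≤ ε / C := by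
      have := Real.rpow_le_rpow h0.le hh2.le h1α.le
      rwa [← Real.rpow_mul (by positivity), one_div_mul_cancel h1α.ne', Real.rpow_one] at this
    have e2 : h = h ^ (1 - α) * h ^ α := by
      rw [← Real.rpow_add h0]; simp
    have e3 : 0 < h ^ α := Real.rpow_pos_of_pos h0 α
    calc C * h = C * h ^ (1 - α) * h ^ α := by rw [mul_assoc, ← e2]
      _ ≤ C * (ε / C) * h ^ α := by gcongr
      _ = ε * h ^ α := by field_simp
  refine le_trans ?_ hpow
  set p : ℝ := max (‖σ + σt‖ - τs) 0 with hp
  have hp0 : 0 ≤ p := le_max_right _ _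
  have hph : p ≤ h := by
    apply max_le _ h0.le
    have := norm_add_le σ σt
    linarith
  obtain ⟨c, hc, hE⟩ : ∃ c : ℝ, |c| ≤ h ∧
      G (σ + σt) (τ + τt) - G σ τ - M (σt, τt)
        = p • (σ - (2 * ν) • τ) - c • ((σ - (2 * ν) • τ) + (σt - (2 * ν) • τt)) := by
    rcases (hJac _ _ _).1 hM with ⟨_, hMf⟩ | ⟨hn, φ, hφ, hMf⟩
    · refine ⟨if τs < ‖σ + σt‖ then ⟪σ + σt, σt⟫ / ‖σ + σt‖ else 0, ?_, ?_⟩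
      · split_ifs with hs
        · have hpos : 0 < ‖σ + σt‖ := hτs.trans hs
          rw [abs_div, abs_norm, div_le_iff₀ hpos]
          have := abs_real_inner_le_norm (σ + σt) σt
          nlinarith
        · simpa using h0.le
      · rw [hMf, hG, hG, hσ, ← hp]
        simp only [sub_self, max_self]
        module
    · refine ⟨⟪σt, φ⟫, ?_, ?_⟩
      · have := abs_real_inner_le_norm σt φ
        nlinarith [norm_nonneg σt]
      · have hpz : p = 0 := by rw [hp, hn]; simp
        rw [hMf, hG, hG, hσ, ← hp, hpz]
        simp only [sub_self, max_self]
        module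
  rw [hE]
  have hw : ‖(σ - (2 * ν) • τ) + (σt - (2 * ν) • τt)‖ ≤ A + (1 + 2 * ν) := by
    have a1 := norm_add_le (σ - (2 * ν) • τ) (σt - (2 * ν) • τt)
    have a2 := norm_sub_le σt ((2 * ν) • τt)
    have a3 : ‖(2 * ν) • τt‖ = 2 * ν * ‖τt‖ := by
      rw [norm_smul, Real.norm_of_nonneg (by positivity)]
    nlinarith
  calc _ ≤ ‖p • (σ - (2 * ν) • τ)‖ + ‖c • ((σ - (2 * ν) • τ) + (σt - (2 * ν) • τt))‖ :=
        norm_sub_le _ _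
    _ = p * A + |c| * ‖(σ - (2 * ν) • τ) + (σt - (2 * ν) • τt)‖ := by
        rw [norm_smul, norm_smul, Real.norm_of_nonneg hp0, Real.norm_eq_abs]
    _ ≤ h * A + h * (A + (1 + 2 * ν)) := by gcongr
    _ = C * h := by rw [hC]; ring
end

section
/- Let d ≥ 1, τ* > 0 and ν > 0. For (σ,τ) ∈ 𝕊 × 𝕊, the equation (|σ| − τ*)⁺ σ − 2ν(τ* + (|σ| − τ*)⁺) τ = 0 holds if and only if the Bingham dichotomy holds: either |σ| ≤ τ* and τ = 0, or |σ| > τ* and σ = 2ντ + τ* τ/|τ| (in which case τ ≠ 0). -/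
open scoped RealInnerProductSpace
open Asymptotics Filter

/-- The equation `(‖σ‖ - τ*)⁺ σ - 2ν(τ* + (‖σ‖ - τ*)⁺) τ = 0` holds if and
only if the Bingham dichotomy holds: either `‖σ‖ ≤ τ*` and `τ = 0`, or `‖σ‖ > τ*`,
`τ ≠ 0` and `σ = 2ντ + τ* τ/‖τ‖`. -/
theorem bingham_max_form_iff_dichotomy {d : ℕ} (hd : 1 ≤ d)
    (τs ν : ℝ) (hτs : 0 < τs) (hν : 0 < ν) (σ τ : SymMat d) :
    max (‖σ‖ - τs) 0 • σ - (2 * ν * (τs + max (‖σ‖ - τs) 0)) • τ = 0 ↔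
      ((‖σ‖ ≤ τs ∧ τ = 0) ∨
        (τs < ‖σ‖ ∧ τ ≠ 0 ∧ σ = (2 * ν) • τ + (τs / ‖τ‖) • τ)) := by
  rcases le_or_gt ‖σ‖ τs with h | h
  · rw [max_eq_right (by linarith)]
    have h1 : 2 * ν * (τs + 0) ≠ 0 := by positivity
    have h2 : ¬ τs < ‖σ‖ := not_lt.mpr h
    rw [zero_smul, zero_sub, neg_eq_zero, smul_eq_zero]
    tauto
  · rw [max_eq_left (by linarith)]
    have hs : 0 < ‖σ‖ := hτs.trans h
    have e : τs + (‖σ‖ - τs) = ‖σ‖ := by ring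
    have h2 : ¬ ‖σ‖ ≤ τs := not_le.mpr h
    rw [e, sub_eq_zero]
    constructor
    · intro H
      have hn := congrArg norm H
      rw [norm_smul, norm_smul, Real.norm_of_nonneg (by linarith),
        Real.norm_of_nonneg (by positivity)] at hn
      have hn' : ‖σ‖ - τs = 2 * ν * ‖τ‖ := by
        apply mul_right_cancel₀ hs.ne'
        linarith
      have hτ : τ ≠ 0 := by
        rintro rfl
        rw [norm_zero] at hn'
        linarith
      have hp : 0 < ‖τ‖ := norm_pos_iff.mpr hτ
      refine Or.inr ⟨h, hτ, ?_⟩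
      have hc : ‖σ‖ - τs ≠ 0 := by linarith
      apply smul_right_injective _ hc
      change (‖σ‖ - τs) • σ = (‖σ‖ - τs) • ((2 * ν) • τ + (τs / ‖τ‖) • τ)
      rw [H, ← add_smul, smul_smul]
      congr 1
      have hs' : ‖σ‖ = 2 * ν * ‖τ‖ + τs := by linarith
      rw [hs']
      field_simp
      ring
    · rintro (⟨h3, _⟩ | ⟨_, hτ, H⟩)
      · exact absurd h3 h2
      · have hp : 0 < ‖τ‖ := norm_pos_iff.mpr hτ
        rw [← add_smul] at H
        have hn := congrArg norm H
        rw [norm_smul, Real.norm_of_nonneg (by positivity)] at hn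
        have hs' : ‖σ‖ = 2 * ν * ‖τ‖ + τs := by
          rw [hn]
          field_simp
        rw [hs']
        rw [H, smul_smul]
        congr 1
        field_simp
        ring
end

section
/- Let d ≥ 1, τ* ≥ 0, ν > 0 and r > 1, and define the Herschel–Bulkley function G : 𝕊 × 𝕊 → 𝕊 by G(σ,τ) := |τ| σ − (τ* + 2ν|τ|^{r−1}) τ. For τ̃ ≠ 0, let M denote the (unique) derivative of G at (σ₀ + σ̃, τ̃); for τ̃ = 0, let M be any map of the form M(s,t) = (t : φ) σ₀ − τ* t with |φ| ≤ 1. Then for every σ₀ ∈ 𝕊, sup over such M of ‖G(σ₀ + σ̃, τ̃) − G(σ₀, 0) − M(σ̃,τ̃)‖ ≤ |τ̃| |σ̃| + 2ν(r−1)|τ̃|^{r} = o(‖(σ̃,τ̃)‖) as (σ̃,τ̃) → (0,0); i.e. G is semismooth at every point of the form (σ₀, 0). -/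
open scoped RealInnerProductSpace
open Asymptotics Filter

/-- General inner product space version. -/
theorem herschel_bulkley_aux {E : Type*} [NormedAddCommGroup E] [InnerProductSpace ℝ E]
    (τs ν r : ℝ) (hτs : 0 ≤ τs) (hν : 0 < ν) (hr : 1 < r)
    (G : E × E → E)
    (hG : ∀ p : E × E,
      G p = ‖p.2‖ • p.1 - (τs + 2 * ν * ‖p.2‖ ^ (r - 1)) • p.2) :
    (∀ σ₀ σt τt : E, ∀ M : E × E →L[ℝ] E,
      ((τt ≠ 0 ∧ HasFDerivAt G M (σ₀ + σt, τt)) ∨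
        (τt = 0 ∧ ∃ φ : E, ‖φ‖ ≤ 1 ∧
          ∀ s t : E, M (s, t) = ⟪t, φ⟫ • σ₀ - τs • t)) →
      ‖G (σ₀ + σt, τt) - G (σ₀, 0) - M (σt, τt)‖
        ≤ ‖τt‖ * ‖σt‖ + 2 * ν * (r - 1) * ‖τt‖ ^ r) ∧
    ((fun p : E × E => ‖p.2‖ * ‖p.1‖ + 2 * ν * (r - 1) * ‖p.2‖ ^ r)
      =o[nhds (0 : E × E)] fun p : E × E => ‖p‖) := by
  refine ⟨?_, ?_⟩
  · rintro σ₀ σt τt M (⟨h0, hM⟩ | ⟨h0, φ, hφ, hM⟩)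
    · have hn : 0 < ‖τt‖ := norm_pos_iff.2 h0
      have hl1 : HasDerivAt (fun s : ℝ => σ₀ + σt + s • σt) σt 0 := by
        simpa using ((hasDerivAt_id (0 : ℝ)).smul_const σt).const_add (σ₀ + σt)
      have hs1 : HasDerivAt (fun s : ℝ => 1 + s) 1 0 := (hasDerivAt_id (0 : ℝ)).const_add 1
      have hl2 : HasDerivAt (fun s : ℝ => (1 + s) • τt) τt 0 := by
        simpa using hs1.smul_const τt
      have hn1 : HasDerivAt (fun s : ℝ => (1 + s) * ‖τt‖) ‖τt‖ 0 := by
        simpa using hs1.mul_const ‖τt‖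
      have hp : HasDerivAt (fun s : ℝ => ((1 + s) * ‖τt‖) ^ (r - 1))
          (‖τt‖ * (r - 1) * ((1 + 0) * ‖τt‖) ^ (r - 1 - 1)) 0 :=
        hn1.rpow_const (Or.inl (by simpa using hn.ne'))
      have hf := (hn1.smul hl1).sub (((hp.const_mul (2 * ν)).const_add τs).smul hl2)
      have hM' : HasFDerivAt G M ((fun s : ℝ => (σ₀ + σt + s • σt, (1 + s) • τt)) 0) := by
        simpa using hM
      have hg := hM'.comp_hasDerivAt (0 : ℝ) (hl1.prodMk hl2)
      have hev : (G ∘ fun s : ℝ => (σ₀ + σt + s • σt, (1 + s) • τt)) =ᶠ[nhds 0]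
          ((fun s : ℝ => (1 + s) * ‖τt‖) • fun s : ℝ => σ₀ + σt + s • σt) -
          ((fun s : ℝ => τs + 2 * ν * ((1 + s) * ‖τt‖) ^ (r - 1)) •
            fun s : ℝ => (1 + s) • τt) := by
        filter_upwards [lt_mem_nhds (show (-1 : ℝ) < 0 by norm_num)] with s hs
        have : ‖(1 + s) • τt‖ = (1 + s) * ‖τt‖ := by
          rw [norm_smul, Real.norm_of_nonneg (by linarith)]
        simp only [Function.comp, hG, this, Pi.sub_apply, Pi.smul_apply']
      have key := hg.unique (hf.congr_of_eventuallyEq hev)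
      have hpw : ‖τt‖ * ‖τt‖ ^ (r - 1 - 1) = ‖τt‖ ^ (r - 1) := by
        rw [Real.rpow_sub_one hn.ne' (r - 1)]; field_simp
      have hpw2 : ‖τt‖ ^ (r - 1) * ‖τt‖ = ‖τt‖ ^ r := by
        rw [Real.rpow_sub_one hn.ne' r]; field_simp
      have hc : 2 * ν * (‖τt‖ * (r - 1) * ‖τt‖ ^ (r - 1 - 1))
          = 2 * ν * (r - 1) * ‖τt‖ ^ (r - 1) := by
        rw [← hpw]; ring
      have e : G (σ₀ + σt, τt) - G (σ₀, 0) - M (σt, τt)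
          = (2 * ν * (r - 1) * ‖τt‖ ^ (r - 1)) • τt - ‖τt‖ • σt := by
        rw [key, hG, hG]
        simp only [add_zero, one_mul, zero_smul, one_smul, norm_zero, smul_zero, hc]
        module
      rw [e]
      refine (norm_sub_le _ _).trans ?_
      have hc0 : 0 ≤ 2 * ν * (r - 1) * ‖τt‖ ^ (r - 1) := by
        have : 0 < r - 1 := by linarith
        positivity
      rw [norm_smul, norm_smul, Real.norm_of_nonneg hc0, norm_norm, mul_assoc _ _ ‖τt‖, hpw2,
        add_comm]
    · subst h0
      have hr0 : r ≠ 0 := by linarith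
      simp [hG, hM, Real.zero_rpow hr0]
  · have h1 : (fun p : E × E => ‖p.2‖) =O[nhds 0] fun p => ‖p‖ :=
      IsBigO.of_bound 1 (Eventually.of_forall fun p => by simpa using norm_snd_le p)
    have t1 : Tendsto (fun p : E × E => ‖p.1‖) (nhds 0) (nhds 0) := by
      have : Continuous fun p : E × E => ‖p.1‖ := by fun_prop
      simpa using this.tendsto 0
    have t2 : Tendsto (fun p : E × E => ‖p.2‖ ^ (r - 1)) (nhds 0) (nhds 0) := by
      have : Continuous fun p : E × E => ‖p.2‖ ^ (r - 1) :=
        (continuous_snd.norm).rpow_const fun _ => Or.inr (by linarith)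
      simpa [Real.zero_rpow (show r - 1 ≠ 0 by linarith)] using this.tendsto 0
    have a1 := h1.mul_isLittleO ((isLittleO_one_iff ℝ).2 t1)
    have a2 := (h1.mul_isLittleO ((isLittleO_one_iff ℝ).2 t2)).const_mul_left (2 * ν * (r - 1))
    have a3 := a1.add a2
    simp only [mul_one] at a3
    refine a3.congr_left fun p => ?_
    congr 2
    rcases (norm_nonneg p.2).eq_or_lt with h | h
    · rw [← h, Real.zero_rpow (show r ≠ 0 by linarith), zero_mul]
    · rw [Real.rpow_sub_one h.ne' r]; field_simp

/-- The Herschel–Bulkley function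
`G(σ,τ) = ‖τ‖ σ - (τ* + 2ν‖τ‖^{r-1}) τ` is semismooth at every point of the form
`(σ₀, 0)`: for `τ̃ ≠ 0` take `M` the (unique) Fréchet derivative of `G` at `(σ₀+σ̃, τ̃)`,
and for `τ̃ = 0` take any `M(s,t) = ⟪t,φ⟫ σ₀ - τ* t` with `‖φ‖ ≤ 1`; then the Newton
remainder is bounded by `‖τ̃‖‖σ̃‖ + 2ν(r-1)‖τ̃‖^r`, which is `o(‖(σ̃,τ̃)‖)`. -/
theorem herschel_bulkley_semismooth_at_zero_strain {d : ℕ} (hd : 1 ≤ d)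
    (τs ν r : ℝ) (hτs : 0 ≤ τs) (hν : 0 < ν) (hr : 1 < r)
    (G : SymMat d × SymMat d → SymMat d)
    (hG : ∀ p : SymMat d × SymMat d,
      G p = ‖p.2‖ • p.1 - (τs + 2 * ν * ‖p.2‖ ^ (r - 1)) • p.2) :
    (∀ σ₀ σt τt : SymMat d, ∀ M : SymMat d × SymMat d →L[ℝ] SymMat d,
      ((τt ≠ 0 ∧ HasFDerivAt G M (σ₀ + σt, τt)) ∨
        (τt = 0 ∧ ∃ φ : SymMat d, ‖φ‖ ≤ 1 ∧
          ∀ s t : SymMat d, M (s, t) = ⟪t, φ⟫ • σ₀ - τs • t)) →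
      ‖G (σ₀ + σt, τt) - G (σ₀, 0) - M (σt, τt)‖
        ≤ ‖τt‖ * ‖σt‖ + 2 * ν * (r - 1) * ‖τt‖ ^ r) ∧
    ((fun p : SymMat d × SymMat d => ‖p.2‖ * ‖p.1‖ + 2 * ν * (r - 1) * ‖p.2‖ ^ r)
      =o[nhds (0 : SymMat d × SymMat d)] fun p : SymMat d × SymMat d => ‖p‖) := by
  exact herschel_bulkley_aux τs ν r hτs hν hr G hG
end
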